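/- For every type-B composition α of n, the set H_α ordered by the weak order (π ≤ σ iff Inv(π) ⊆ Inv(σ)) is a lattice, and the equivalence relation Θ on H_α defined by (π,σ) ∈ Θ iff Π↓(π) = Π↓(σ) is a lattice congruence of it: for all π₁, π₂, σ₁, σ₂ ∈ H_α with Π↓(π₁) = Π↓(σ₁) and Π↓(π₂) = Π↓(σ₂), one has Π↓(π₁ ∨ π₂) = Π↓(σ₁ ∨ σ₂) and Π↓(π₁ ∧ π₂) = Π↓(σ₁ ∧ σ₂), where ∨ and ∧ denote the join and meet in the lattice (H_α, ≤). Moreover, Π↓(π) is the least element of the Θ-class of π. -/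

import Mathlib

namespace TypeB

/-- A sign-symmetric permutation of degree `n`: a bijection of `ℤ` with
`π(-i) = -π(i)` which fixes every integer of absolute value `> n`.
It restricts to a sign-symmetric permutation of `±[n]`. -/
structure SignedPerm (n : ℕ) where
  perm : Equiv.Perm ℤ
  sign_symm : ∀ i : ℤ, perm (-i) = - perm i
  outside : ∀ i : ℤ, (n : ℤ) < |i| → perm i = i

/-- Symbols for type-B inversions: `neg i` is `[i]`, `pair i j` (with `i < j`)
is `(i,j)`, and `mixed i j` (with `i < j`) is `(−j, i)`. -/
inductive BInv (n : ℕ) : Type where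
  | neg : ℕ → BInv n
  | pair : ℕ → ℕ → BInv n
  | mixed : ℕ → ℕ → BInv n
deriving DecidableEq

/-- `i⁺`: `i+1` if `i ≠ -1`, and `1` for `i = -1`. -/
def iplus (i : ℤ) : ℤ := if i = -1 then 1 else i + 1

/-- The inversion set of a sign-symmetric permutation. -/
def Inv {n : ℕ} (π : SignedPerm n) : Set (BInv n) := fun t =>
  match t with
  | .neg i => 1 ≤ i ∧ i ≤ n ∧ π.perm (i : ℤ) < 0
  | .pair i j => 1 ≤ i ∧ i < j ∧ j ≤ n ∧ π.perm (j : ℤ) < π.perm (i : ℤ)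
  | .mixed i j => 1 ≤ i ∧ i < j ∧ j ≤ n ∧ π.perm (i : ℤ) + π.perm (j : ℤ) < 0

/-- The cover-inversion set of a sign-symmetric permutation. -/
def Cov {n : ℕ} (π : SignedPerm n) : Set (BInv n) := fun t =>
  match t with
  | .neg i => 1 ≤ i ∧ i ≤ n ∧ π.perm (i : ℤ) = -1
  | .pair i j => 1 ≤ i ∧ i < j ∧ j ≤ n ∧ π.perm (i : ℤ) = iplus (π.perm (j : ℤ))
  | .mixed i j => 1 ≤ i ∧ i < j ∧ j ≤ n ∧ π.perm (-(j : ℤ)) = iplus (π.perm (i : ℤ))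

/-- The symbol `(−j, i)` in canonical form (it equals `(−i, j)`). -/
def mixedInv {n : ℕ} (i j : ℕ) : BInv n := .mixed (min i j) (max i j)

/-- A type-B composition of `n`: positive parts summing to `n`,
together with a split/join label. -/
structure BComp (n : ℕ) where
  parts : List ℕ
  pos : ∀ a ∈ parts, 0 < a
  sum_eq : parts.sum = n
  isJoin : Bool

/-- The partial sum `p_i = α₁ + ⋯ + α_i`. -/
def pSum {n : ℕ} (α : BComp n) (i : ℕ) : ℕ := (α.parts.take i).sum

/-- The α-region of `a ∈ [n]`: the unique `i` with `p_{i-1} < a ≤ p_i`. -/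
def region {n : ℕ} (α : BComp n) (a : ℕ) : ℕ :=
  ((Finset.range α.parts.length).filter (fun j => pSum α j < a)).card

/-- The first part `α₁` of a type-B composition. -/
def alpha1 {n : ℕ} (α : BComp n) : ℕ := α.parts.headI

/-- Index of the block of `Part(α)` containing `x ∈ ±[n]`; two elements lie in
a common block of `Part(α)` iff their indices agree. -/
def blockIdx {n : ℕ} (α : BComp n) (x : ℤ) : ℤ :=
  if 0 < x then
    (if α.isJoin = true ∧ region α x.toNat = 1 then 0 else (region α x.toNat : ℤ))
  else
    (if α.isJoin = true ∧ region α (-x).toNat = 1 then 0 else -(region α (-x).toNat : ℤ))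

/-- Membership in `±[n]`. -/
def inPM (n : ℕ) (x : ℤ) : Prop := x ≠ 0 ∧ -(n : ℤ) ≤ x ∧ x ≤ (n : ℤ)

/-- `π ∈ H_α`: `π` is increasing on every block of `Part(α)`. -/
def memH {n : ℕ} (α : BComp n) (π : SignedPerm n) : Prop :=
  ∀ a b : ℤ, inPM n a → inPM n b → a < b → blockIdx α a = blockIdx α b →
    π.perm a < π.perm b

/-- Common part of the type-B `(α,231)`- and `(α,312)`-patterns: indices
`i < j < k` in `±[n]`, in pairwise distinct blocks of `Part(α)`, with `j > 0`
and `π(i) = π(k)⁺`. -/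
def patternCore {n : ℕ} (α : BComp n) (π : SignedPerm n) (i j k : ℤ) : Prop :=
  inPM n i ∧ inPM n j ∧ inPM n k ∧ i < j ∧ j < k ∧ 0 < j ∧
  blockIdx α i ≠ blockIdx α j ∧ blockIdx α j ≠ blockIdx α k ∧
  blockIdx α i ≠ blockIdx α k ∧ π.perm i = iplus (π.perm k)

/-- `π` has a type-B `(α,231)`-split (resp. -join) pattern, according to the
label of `α`. -/
def has231 {n : ℕ} (α : BComp n) (π : SignedPerm n) : Prop :=
  ∃ i j k : ℤ, patternCore α π i j k ∧
    (if α.isJoin = true then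
       (((alpha1 α : ℤ) < j → π.perm i < π.perm j) ∧
        (j ≤ (alpha1 α : ℤ) → π.perm j < π.perm k))
     else π.perm i < π.perm j)

/-- `π` has a type-B `(α,312)`-split (resp. -join) pattern, according to the
label of `α`. -/
def has312 {n : ℕ} (α : BComp n) (π : SignedPerm n) : Prop :=
  ∃ i j k : ℤ, patternCore α π i j k ∧
    (if α.isJoin = true then
       (((alpha1 α : ℤ) < j → π.perm j < π.perm k) ∧
        (j ≤ (alpha1 α : ℤ) → π.perm i < π.perm j))
     else π.perm j < π.perm k)

/-- `π ∈ H_α(231)`. -/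
def mem231 {n : ℕ} (α : BComp n) (π : SignedPerm n) : Prop := memH α π ∧ ¬ has231 α π

/-- `π ∈ H_α(312)`. -/
def mem312 {n : ℕ} (α : BComp n) (π : SignedPerm n) : Prop := memH α π ∧ ¬ has312 α π

/-- The set `H_α`. -/
def Hset {n : ℕ} (α : BComp n) : Set (SignedPerm n) := {π | memH α π}

/-- The carrier of `Tam_B(α)`, namely `H_α(231)`. -/
def Tset {n : ℕ} (α : BComp n) : Set (SignedPerm n) := {π | mem231 α π}

/-- The weak order: inclusion of inversion sets. -/
def wle {n : ℕ} (π σ : SignedPerm n) : Prop := Inv π ⊆ Inv σ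

/-- `m` is the greatest lower bound of `x` and `y` within `P`, w.r.t. the weak order. -/
def isMeetIn {n : ℕ} (P : Set (SignedPerm n)) (x y m : SignedPerm n) : Prop :=
  m ∈ P ∧ wle m x ∧ wle m y ∧ ∀ z ∈ P, wle z x → wle z y → wle z m

/-- `u` is the least upper bound of `x` and `y` within `P`, w.r.t. the weak order. -/
def isJoinIn {n : ℕ} (P : Set (SignedPerm n)) (x y u : SignedPerm n) : Prop :=
  u ∈ P ∧ wle x u ∧ wle y u ∧ ∀ z ∈ P, wle x z → wle y z → wle u z

/-- `d = Π↓(π)`: `d` is the greatest element of `{σ ∈ H_α(231) : Inv σ ⊆ Inv π}`. -/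
def isProjDown {n : ℕ} (α : BComp n) (π d : SignedPerm n) : Prop :=
  mem231 α d ∧ wle d π ∧ ∀ σ, mem231 α σ → wle σ π → wle σ d

/-- `d = Π†(π)`: `d` is the greatest element of `{σ ∈ H_α(312) : Inv σ ⊆ Inv π}`. -/
def isProjDagger {n : ℕ} (α : BComp n) (π d : SignedPerm n) : Prop :=
  mem312 α d ∧ wle d π ∧ ∀ σ, mem312 α σ → wle σ π → wle σ d

/-- The value `ω_{o;α}(a)` for `a ∈ [n]`. -/
def omegaPos {n : ℕ} (α : BComp n) (a : ℕ) : ℤ :=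
  if α.isJoin = true ∧ region α a = 1 then (a : ℤ)
  else -(((pSum α (region α a) : ℤ) + (pSum α (region α a - 1) : ℤ) + 1) - (a : ℤ))

/-- The longest element `ω_{o;α}` of `H_α`, as a function on `ℤ`. -/
def omegaFun {n : ℕ} (α : BComp n) (x : ℤ) : ℤ :=
  if 0 < x ∧ x ≤ (n : ℤ) then omegaPos α x.toNat
  else if 0 < -x ∧ -x ≤ (n : ℤ) then -(omegaPos α (-x).toNat)
  else x

/-- The set of `m` such that there is a strict chain `x₀ < x₁ < ⋯ < x_m` in `P`. -/
def chainLengths {n : ℕ} (P : Set (SignedPerm n)) : Set ℕ :=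
  {m | ∃ f : Fin (m + 1) → SignedPerm n, (∀ i, f i ∈ P) ∧
        ∀ i j : Fin (m + 1), i < j → Inv (f i) ⊂ Inv (f j)}

/-- `x` is join-irreducible in `Tam_B(α)`. -/
def joinIrred {n : ℕ} (α : BComp n) (x : SignedPerm n) : Prop :=
  x ∈ Tset α ∧ ¬ (∀ y ∈ Tset α, wle x y) ∧
  ∀ y z, y ∈ Tset α → z ∈ Tset α → isJoinIn (Tset α) y z x → x = y ∨ x = z

/-- `x` is meet-irreducible in `Tam_B(α)`. -/
def meetIrred {n : ℕ} (α : BComp n) (x : SignedPerm n) : Prop :=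
  x ∈ Tset α ∧ ¬ (∀ y ∈ Tset α, wle y x) ∧
  ∀ y z, y ∈ Tset α → z ∈ Tset α → isMeetIn (Tset α) y z x → x = y ∨ x = z

/-- `x` is left modular in the lattice on `P`: `(r ∨ x) ∧ q = r ∨ (x ∧ q)`
for all `r ≤ q` in `P`. -/
def leftModular {n : ℕ} (P : Set (SignedPerm n)) (x : SignedPerm n) : Prop :=
  ∀ r q, r ∈ P → q ∈ P → wle r q →
    ∀ u v w1 w2, isJoinIn P r x u → isMeetIn P u q v →
      isMeetIn P x q w1 → isJoinIn P r w1 w2 → v = w2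

/-- The simple generator `s_i` as a function on `ℤ`: `s₀` exchanges `1` and `-1`,
and for `i ≥ 1`, `s_i` exchanges `i` with `i+1` and `-i` with `-(i+1)`. -/
def sfun (i : ℕ) (x : ℤ) : ℤ :=
  if i = 0 then (if x = 1 then -1 else if x = -1 then 1 else x)
  else if x = (i : ℤ) then (i : ℤ) + 1
  else if x = (i : ℤ) + 1 then (i : ℤ)
  else if x = -(i : ℤ) then -(i : ℤ) - 1
  else if x = -(i : ℤ) - 1 then -(i : ℤ)
  else x

/-- `i` is one of the partial sums `p₁, …, p_{r−1}` of `α`. -/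
def isPSum {n : ℕ} (α : BComp n) (i : ℕ) : Prop :=
  ∃ j : ℕ, 1 ≤ j ∧ j < α.parts.length ∧ pSum α j = i

/-- `n² − Σᵢ α_i(α_i−1)/2`, minus additionally `(α₁+1)α₁/2` when `α` is join. -/
def lengthFormula {n : ℕ} (α : BComp n) : ℕ :=
  n ^ 2 - (α.parts.map (fun a => a * (a - 1) / 2)).sum -
    (if α.isJoin = true then (alpha1 α + 1) * alpha1 α / 2 else 0)

/-- `a < b` is an inversion of `π`, as a pair of elements of `±[n]`. -/
def IsInv {n : ℕ} (π : SignedPerm n) (a b : ℤ) : Prop :=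
  inPM n a ∧ inPM n b ∧ a < b ∧ π.perm b < π.perm a

lemma inPM.neg {n : ℕ} {a : ℤ} (h : inPM n a) : inPM n (-a) := by
  unfold inPM at *; omega

lemma SignedPerm.perm_zero {n : ℕ} (π : SignedPerm n) : π.perm 0 = 0 := by
  have := π.sign_symm 0
  simp only [neg_zero] at this
  omega

lemma SignedPerm.perm_inPM {n : ℕ} (π : SignedPerm n) {a : ℤ} (h : inPM n a) :
    inPM n (π.perm a) := by
  have h0 : π.perm a ≠ 0 := by
    intro h'
    rw [← π.perm_zero] at h'
    exact h.1 (π.perm.injective h')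
  have h1 : |π.perm a| ≤ n := by
    by_contra! hc
    have h2 : π.perm a = a := π.perm.injective (π.outside _ hc)
    rw [h2] at hc
    have : |a| ≤ n := abs_le.2 h.2
    omega
  exact ⟨h0, abs_le.1 h1⟩

lemma SignedPerm.exists_perm_eq {n : ℕ} (π : SignedPerm n) {v : ℤ} (h : inPM n v) :
    ∃ a, inPM n a ∧ π.perm a = v := by
  refine ⟨π.perm.symm v, ⟨?_, ?_⟩, by simp⟩
  · intro h'
    rw [Equiv.symm_apply_eq, π.perm_zero] at h'
    exact h.1 h'
  · apply abs_le.1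
    by_contra! hc
    have h2 := π.outside _ hc
    simp only [Equiv.apply_symm_apply] at h2
    rw [← h2] at hc
    have : |v| ≤ n := abs_le.2 h.2
    omega

lemma SignedPerm.perm_ne {n : ℕ} (π : SignedPerm n) {a b : ℤ} (h : a ≠ b) :
    π.perm a ≠ π.perm b := fun h' => h (π.perm.injective h')

/-- The weak order is inclusion of inversions viewed as pairs in `±[n]`. -/
lemma wle_iff {n : ℕ} {π σ : SignedPerm n} :
    wle π σ ↔ ∀ a b, IsInv π a b → IsInv σ a b := by
  constructor
  · intro h a b ⟨ha, hb, hab, hlt⟩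
    refine ⟨ha, hb, hab, ?_⟩
    have hπa := π.sign_symm a
    have hπb := π.sign_symm b
    have hσa := σ.sign_symm a
    have hσb := σ.sign_symm b
    obtain ⟨ha0, ha1, ha2⟩ := ha
    obtain ⟨hb0, hb1, hb2⟩ := hb
    rcases lt_or_gt_of_ne ha0 with han | hap
    · rcases lt_or_gt_of_ne hb0 with hbn | hbp
      · lift -a to ℕ using (by omega) with a' ha'
        lift -b to ℕ using (by omega) with b' hb'
        have := @h (.pair b' a') ⟨by omega, by omega, by omega, by omega⟩
        have := this.2.2.2
        omega
      · lift -a to ℕ using (by omega) with a' ha'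
        lift b to ℕ using (by omega) with b'
        rcases lt_trichotomy a' b' with hc | hc | hc
        · have := @h (.mixed a' b') ⟨by omega, by omega, by omega, by omega⟩
          have := this.2.2.2
          omega
        · subst hc
          have := @h (.neg a') ⟨by omega, by omega, by omega⟩
          have := this.2.2
          omega
        · have := @h (.mixed b' a') ⟨by omega, by omega, by omega, by omega⟩
          have := this.2.2.2
          omega
    · lift a to ℕ using hap.le with a'
      lift b to ℕ using (by omega) with b'
      exact (@h (.pair a' b') ⟨by omega, by omega, by omega, hlt⟩).2.2.2
  · intro h t ht
    rcases t with i | ⟨i, j⟩ | ⟨i, j⟩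
    · obtain ⟨h1, h2, h3⟩ := ht
      have hπ := π.sign_symm i
      have hσ := σ.sign_symm i
      obtain ⟨-, -, -, h4⟩ := h (-i) i ⟨⟨by omega, by omega, by omega⟩,
        ⟨by omega, by omega, by omega⟩, by omega, by omega⟩
      exact ⟨h1, h2, by omega⟩
    · obtain ⟨h1, h2, h3, h4⟩ := ht
      obtain ⟨-, -, -, h5⟩ := h i j ⟨⟨by omega, by omega, by omega⟩,
        ⟨by omega, by omega, by omega⟩, by omega, by omega⟩
      exact ⟨h1, h2, h3, by omega⟩
    · obtain ⟨h1, h2, h3, h4⟩ := ht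
      have hπ := π.sign_symm j
      have hσ := σ.sign_symm j
      obtain ⟨-, -, -, h5⟩ := h (-j) i ⟨⟨by omega, by omega, by omega⟩,
        ⟨by omega, by omega, by omega⟩, by omega, by omega⟩
      exact ⟨h1, h2, h3, by omega⟩

lemma wle.trans {n : ℕ} {π σ τ : SignedPerm n} (h : wle π σ) (h' : wle σ τ) : wle π τ :=
  Set.Subset.trans h h'

lemma perm_lt_iff_of_wle_of_wle {n : ℕ} {π σ : SignedPerm n} (h : wle π σ) (h' : wle σ π)
    {a b : ℤ} (ha : inPM n a) (hb : inPM n b) :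
    π.perm a < π.perm b ↔ σ.perm a < σ.perm b := by
  have h1 := fun a b => Iff.intro (wle_iff.1 h a b) (wle_iff.1 h' a b)
  rcases lt_trichotomy a b with hab | rfl | hab
  · have := h1 a b
    have hp := π.perm_ne hab.ne
    have hs := σ.perm_ne hab.ne
    simp only [IsInv, ha, hb, hab, true_and] at this
    omega
  · simp
  · have := h1 b a
    simpa only [IsInv, ha, hb, hab, true_and] using this

/-- The elements of `±[n]`. -/
noncomputable def pmFinset (n : ℕ) : Finset ℤ := (Finset.Icc (-(n : ℤ)) n).erase 0

lemma mem_pmFinset {n : ℕ} {a : ℤ} : a ∈ pmFinset n ↔ inPM n a := by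
  simp [pmFinset, inPM]

lemma card_pmFinset (n : ℕ) : (pmFinset n).card = 2 * n := by
  rw [pmFinset, Finset.card_erase_of_mem (by simp), Int.card_Icc]
  omega

lemma SignedPerm.image_pmFinset {n : ℕ} (π : SignedPerm n) :
    (pmFinset n).image π.perm = pmFinset n := by
  ext v
  simp only [Finset.mem_image, mem_pmFinset]
  constructor
  · rintro ⟨a, ha, rfl⟩
    exact π.perm_inPM ha
  · exact π.exists_perm_eq

/-- The weak order is antisymmetric. -/
lemma wle.antisymm {n : ℕ} {π σ : SignedPerm n} (h : wle π σ) (h' : wle σ π) : π = σ := by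
  have key : ∀ a, inPM n a → π.perm a = σ.perm a := by
    intro a ha
    have hcard : ∀ τ : SignedPerm n,
        ((pmFinset n).filter (fun b => τ.perm b < τ.perm a)).card =
          ((pmFinset n).filter (fun v => v < τ.perm a)).card := by
      intro τ
      conv_rhs => rw [← τ.image_pmFinset, Finset.filter_image]
      exact (Finset.card_image_of_injective _ τ.perm.injective).symm
    have hlt : ∀ u v, inPM n u → u < v → ((pmFinset n).filter (fun x => x < u)).card <
        ((pmFinset n).filter (fun x => x < v)).card := by
      intro u v hu huv
      apply Finset.card_lt_card
      rw [Finset.ssubset_iff_of_subset]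
      · exact ⟨u, by simp [mem_pmFinset, hu, huv], by simp⟩
      · exact Finset.monotone_filter_right _ (fun x _ hx => lt_trans hx huv)
    have hfilter : (pmFinset n).filter (fun b => π.perm b < π.perm a) =
        (pmFinset n).filter (fun b => σ.perm b < σ.perm a) := by
      apply Finset.filter_congr
      intro b hb
      exact perm_lt_iff_of_wle_of_wle h h' (mem_pmFinset.1 hb) ha
    have heq := (hcard π).symm.trans ((congrArg Finset.card hfilter).trans (hcard σ))
    rcases lt_trichotomy (π.perm a) (σ.perm a) with hc | hc | hc
    · exact absurd heq (hlt _ _ (π.perm_inPM ha) hc).ne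
    · exact hc
    · exact absurd heq (hlt _ _ (σ.perm_inPM ha) hc).ne'
  have hperm : π.perm = σ.perm := by
    ext a
    by_cases ha : inPM n a
    · exact key a ha
    · by_cases h0 : a = 0
      · rw [h0, π.perm_zero, σ.perm_zero]
      · have : (n : ℤ) < |a| := by
          by_contra! hc
          exact ha ⟨h0, abs_le.1 hc⟩
        rw [π.outside _ this, σ.outside _ this]
  cases π
  cases σ
  simpa using hperm

/-- A relation on `±[n]` contained in `<` which is cotransitive and sign-symmetric. -/
structure Coclosed (n : ℕ) (r : ℤ → ℤ → Prop) : Prop where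
  dom : ∀ {a b}, r a b → inPM n a ∧ inPM n b ∧ a < b
  cotrans : ∀ {a b c}, r a c → inPM n b → a < b → b < c → r a b ∨ r b c
  symm : ∀ {a b}, r a b → r (-b) (-a)

/-- A coclosed relation which is moreover transitive. -/
structure Biclosed (n : ℕ) (r : ℤ → ℤ → Prop) : Prop extends Coclosed n r where
  trans : ∀ {a b c}, r a b → r b c → r a c

lemma biclosed_isInv {n : ℕ} (π : SignedPerm n) : Biclosed n (IsInv π) where
  dom h := ⟨h.1, h.2.1, h.2.2.1⟩
  cotrans {a b c} h hb hab hbc := by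
    by_cases hc : π.perm b < π.perm a
    · exact .inl ⟨h.1, hb, hab, hc⟩
    · exact .inr ⟨hb, h.2.1, hbc, by have := h.2.2.2; omega⟩
  symm {a b} h := by
    refine ⟨h.2.1.neg, h.1.neg, by have := h.2.2.1; omega, ?_⟩
    rw [π.sign_symm, π.sign_symm]
    have := h.2.2.2
    omega
  trans h h' := ⟨h.1, h'.2.1, h.2.2.1.trans h'.2.2.1, h'.2.2.2.trans h.2.2.2⟩

lemma Coclosed.sup {n : ℕ} {r s : ℤ → ℤ → Prop} (hr : Coclosed n r) (hs : Coclosed n s) :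
    Coclosed n (r ⊔ s) where
  dom h := h.elim hr.dom hs.dom
  cotrans h hb hab hbc := by
    rcases h with h | h
    · exact (hr.cotrans h hb hab hbc).imp .inl .inl
    · exact (hs.cotrans h hb hab hbc).imp .inr .inr
  symm h := h.imp hr.symm hs.symm

lemma Coclosed.dom_transGen {n : ℕ} {r : ℤ → ℤ → Prop} (hr : Coclosed n r) {a b : ℤ}
    (h : Relation.TransGen r a b) : inPM n a ∧ inPM n b ∧ a < b := by
  induction h with
  | single h => exact hr.dom h
  | tail _ h ih =>
    have := hr.dom h
    exact ⟨ih.1, this.2.1, ih.2.2.trans this.2.2⟩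

lemma Coclosed.biclosed_transGen {n : ℕ} {r : ℤ → ℤ → Prop} (hr : Coclosed n r) :
    Biclosed n (Relation.TransGen r) where
  dom := hr.dom_transGen
  trans := Relation.TransGen.trans
  symm {a b} h := by
    induction h with
    | single h => exact .single (hr.symm h)
    | tail _ h ih => exact .head (hr.symm h) ih
  cotrans {a b c} h hb hab := by
    induction h with
    | single h =>
      intro hbc
      exact (hr.cotrans h hb hab hbc).imp .single .single
    | @tail d e had hde ih =>
      intro hbc
      rcases lt_trichotomy b d with hbd | rfl | hbd
      · exact (ih hbd).imp id (fun h => h.tail hde)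
      · exact .inl had
      · exact (hr.cotrans hde hb hbd hbc).imp had.tail .single

/-- The complement of a relation within the pairs `a < b` of `±[n]`. -/
def complRel (n : ℕ) (r : ℤ → ℤ → Prop) (a b : ℤ) : Prop :=
  inPM n a ∧ inPM n b ∧ a < b ∧ ¬ r a b

lemma Biclosed.compl {n : ℕ} {r : ℤ → ℤ → Prop} (hr : Biclosed n r) :
    Biclosed n (complRel n r) where
  dom h := ⟨h.1, h.2.1, h.2.2.1⟩
  cotrans {a b c} h hb hab hbc := by
    by_contra! hc
    simp only [complRel, h.1, h.2.1, hb, hab, hbc, true_and, not_not] at hc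
    exact h.2.2.2 (hr.trans hc.1 hc.2)
  symm {a b} h := by
    refine ⟨h.2.1.neg, h.1.neg, by have := h.2.2.1; omega, fun h' => h.2.2.2 ?_⟩
    simpa using hr.symm h'
  trans {a b c} h h' := by
    refine ⟨h.1, h'.2.1, h.2.2.1.trans h'.2.2.1, fun h'' => ?_⟩
    rcases hr.cotrans h'' h.2.1 h.2.2.1 h'.2.2.1 with h1 | h1
    · exact h.2.2.2 h1
    · exact h'.2.2.2 h1

/-- The strict total order on `±[n]` whose inversions are given by `r`. -/
def precRel (r : ℤ → ℤ → Prop) (a b : ℤ) : Prop := (a < b ∧ ¬ r a b) ∨ (b < a ∧ r b a)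

lemma precRel_irrefl (r : ℤ → ℤ → Prop) (a : ℤ) : ¬ precRel r a a := by
  simp [precRel]

lemma precRel_total (r : ℤ → ℤ → Prop) {a b : ℤ} (hab : a ≠ b) :
    precRel r a b ∨ precRel r b a := by
  unfold precRel
  rcases lt_or_gt_of_ne hab with h | h <;> tauto

lemma Biclosed.precRel_trans {n : ℕ} {r : ℤ → ℤ → Prop} (hr : Biclosed n r) {a b c : ℤ}
    (ha : inPM n a) (hb : inPM n b) (hc : inPM n c) (hab : precRel r a b)
    (hbc : precRel r b c) : precRel r a c := by
  have t := @hr.trans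
  have ct := @hr.cotrans
  unfold precRel at *
  rcases lt_trichotomy a c with h | rfl | h
  · left
    refine ⟨h, fun hac => ?_⟩
    rcases hab with hab | hab <;> rcases hbc with hbc | hbc
    · rcases ct hac hb hab.1 hbc.1 with h' | h' <;> tauto
    · exact hab.2 (t hac hbc.2)
    · exact hbc.2 (t hab.2 hac)
    · omega
  · rcases hab with hab | hab <;> rcases hbc with hbc | hbc <;> first | omega | tauto
  · right
    refine ⟨h, ?_⟩
    rcases hab with hab | hab <;> rcases hbc with hbc | hbc
    · omega
    · rcases ct hbc.2 ha h hab.1 with h' | h' <;> tauto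
    · rcases ct hab.2 hc hbc.1 h with h' | h' <;> tauto
    · exact t hbc.2 hab.2

lemma Biclosed.precRel_neg {n : ℕ} {r : ℤ → ℤ → Prop} (hr : Biclosed n r) {a b : ℤ}
    (h : precRel r a b) : precRel r (-b) (-a) := by
  rcases h with ⟨h, h'⟩ | ⟨h, h'⟩
  · exact .inl ⟨by omega, fun h'' => h' (by simpa using hr.symm h'')⟩
  · exact .inr ⟨by omega, hr.symm h'⟩

open Classical in
/-- The rank of `a` in the order `precRel r` on `±[n]`. -/
noncomputable def rankRel (n : ℕ) (r : ℤ → ℤ → Prop) (a : ℤ) : ℕ :=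
  ((pmFinset n).filter (fun b => precRel r b a)).card

lemma Biclosed.rankRel_lt {n : ℕ} {r : ℤ → ℤ → Prop} (hr : Biclosed n r) {a b : ℤ}
    (ha : inPM n a) (hb : inPM n b) (h : precRel r a b) :
    rankRel n r a < rankRel n r b := by
  classical
  apply Finset.card_lt_card
  rw [Finset.ssubset_iff_of_subset]
  · refine ⟨a, ?_, ?_⟩
    · simp [mem_pmFinset, ha, h]
    · simp [precRel_irrefl]
  · intro x hx
    simp only [Finset.mem_filter, mem_pmFinset] at hx ⊢
    exact ⟨hx.1, hr.precRel_trans hx.1 ha hb hx.2 h⟩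

lemma Biclosed.rankRel_neg {n : ℕ} {r : ℤ → ℤ → Prop} (hr : Biclosed n r) {a : ℤ}
    (ha : inPM n a) : rankRel n r a + rankRel n r (-a) + 1 = 2 * n := by
  classical
  have h1 : rankRel n r (-a) = ((pmFinset n).filter (fun b => precRel r a b)).card := by
    apply Finset.card_nbij' (fun x => -x) (fun x => -x)
    · intro x hx
      simp only [Finset.coe_filter, Set.mem_ofPred_eq, mem_pmFinset] at hx ⊢
      exact ⟨hx.1.neg, by simpa using hr.precRel_neg hx.2⟩
    · intro x hx
      simp only [Finset.coe_filter, Set.mem_ofPred_eq, mem_pmFinset] at hx ⊢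
      exact ⟨hx.1.neg, hr.precRel_neg hx.2⟩
    · exact fun x _ => neg_neg x
    · exact fun x _ => neg_neg x
  have h2 : ((pmFinset n).erase a).card + 1 = 2 * n := by
    rw [Finset.card_erase_add_one (mem_pmFinset.2 ha), card_pmFinset]
  rw [← h2, h1, rankRel, ← Finset.card_union_of_disjoint]
  · congr 2
    ext x
    simp only [Finset.mem_union, Finset.mem_filter, Finset.mem_erase, mem_pmFinset]
    constructor
    · rintro (⟨hx, h⟩ | ⟨hx, h⟩)
      · exact ⟨fun e => precRel_irrefl r a (e ▸ h), hx⟩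
      · exact ⟨fun e => precRel_irrefl r a (e ▸ h), hx⟩
    · rintro ⟨hne, hx⟩
      exact (precRel_total r hne).imp (fun h => ⟨hx, h⟩) (fun h => ⟨hx, h⟩)
  · rw [Finset.disjoint_filter]
    intro x hx h h'
    rw [mem_pmFinset] at hx
    exact precRel_irrefl r x (hr.precRel_trans hx ha hx h h')

open Classical in
/-- The map sending `a ∈ ±[n]` to the element of `±[n]` of the same rank as `a` has
in the order `precRel r`. -/
noncomputable def rankFun (n : ℕ) (r : ℤ → ℤ → Prop) (a : ℤ) : ℤ :=
  if inPM n a then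
    (if rankRel n r a < n then (rankRel n r a : ℤ) - n else (rankRel n r a : ℤ) - n + 1)
  else a

lemma Biclosed.rankFun_inPM {n : ℕ} {r : ℤ → ℤ → Prop} (hr : Biclosed n r) {a : ℤ}
    (ha : inPM n a) : inPM n (rankFun n r a) := by
  have := hr.rankRel_neg ha
  rw [rankFun, if_pos ha]
  unfold inPM
  split_ifs <;> omega

lemma Biclosed.rankFun_lt {n : ℕ} {r : ℤ → ℤ → Prop} (hr : Biclosed n r) {a b : ℤ}
    (ha : inPM n a) (hb : inPM n b) (h : precRel r a b) : rankFun n r a < rankFun n r b := by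
  have := hr.rankRel_lt ha hb h
  rw [rankFun, if_pos ha, rankFun, if_pos hb]
  split_ifs <;> omega

lemma Biclosed.rankFun_neg {n : ℕ} {r : ℤ → ℤ → Prop} (hr : Biclosed n r) (a : ℤ) :
    rankFun n r (-a) = - rankFun n r a := by
  by_cases ha : inPM n a
  · have := hr.rankRel_neg ha
    rw [rankFun, if_pos ha.neg, rankFun, if_pos ha]
    split_ifs <;> omega
  · have ha' : ¬ inPM n (-a) := fun h => ha (by simpa using h.neg)
    rw [rankFun, if_neg ha', rankFun, if_neg ha]

lemma Biclosed.rankFun_injective {n : ℕ} {r : ℤ → ℤ → Prop} (hr : Biclosed n r) :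
    Function.Injective (rankFun n r) := by
  intro a b hab
  by_cases ha : inPM n a <;> by_cases hb : inPM n b
  · by_contra hne
    rcases precRel_total r hne with h | h
    · exact (hr.rankFun_lt ha hb h).ne hab
    · exact (hr.rankFun_lt hb ha h).ne' hab
  · have := hr.rankFun_inPM ha
    rw [hab, rankFun, if_neg hb] at this
    exact absurd this hb
  · have := hr.rankFun_inPM hb
    rw [← hab, rankFun, if_neg ha] at this
    exact absurd this ha
  · rwa [rankFun, if_neg ha, rankFun, if_neg hb] at hab

lemma Biclosed.rankFun_surjective {n : ℕ} {r : ℤ → ℤ → Prop} (hr : Biclosed n r) :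
    Function.Surjective (rankFun n r) := by
  intro v
  by_cases hv : inPM n v
  · have himg : (pmFinset n).image (rankFun n r) = pmFinset n := by
      apply Finset.eq_of_subset_of_card_le
      · intro x hx
        obtain ⟨a, ha, rfl⟩ := Finset.mem_image.1 hx
        exact mem_pmFinset.2 (hr.rankFun_inPM (mem_pmFinset.1 ha))
      · rw [Finset.card_image_of_injective _ hr.rankFun_injective]
    rw [← mem_pmFinset, ← himg] at hv
    obtain ⟨a, -, ha⟩ := Finset.mem_image.1 hv
    exact ⟨a, ha⟩
  · exact ⟨v, by rw [rankFun, if_neg hv]⟩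

/-- Every biclosed relation is the set of inversions of a sign-symmetric permutation. -/
theorem Biclosed.exists_signedPerm {n : ℕ} {r : ℤ → ℤ → Prop} (hr : Biclosed n r) :
    ∃ π : SignedPerm n, ∀ a b, IsInv π a b ↔ r a b := by
  have hbij : Function.Bijective (rankFun n r) := ⟨hr.rankFun_injective, hr.rankFun_surjective⟩
  refine ⟨⟨Equiv.ofBijective _ hbij, hr.rankFun_neg, ?_⟩, ?_⟩
  · intro i hi
    have : ¬ inPM n i := fun h => absurd (abs_le.2 h.2) (not_le.2 hi)
    rw [Equiv.ofBijective_apply, rankFun, if_neg this]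
  · intro a b
    simp only [IsInv, Equiv.ofBijective_apply]
    constructor
    · rintro ⟨ha, hb, hab, hlt⟩
      by_contra hc
      exact lt_asymm hlt (hr.rankFun_lt ha hb (.inl ⟨hab, hc⟩))
    · intro h
      obtain ⟨ha, hb, hab⟩ := hr.dom h
      exact ⟨ha, hb, hab, hr.rankFun_lt hb ha (.inr ⟨hab, h⟩)⟩

lemma region_mono {n : ℕ} (α : BComp n) {a b : ℕ} (h : a ≤ b) : region α a ≤ region α b :=
  Finset.card_le_card (Finset.monotone_filter_right _ (fun _ _ hx => lt_of_lt_of_le hx h))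

lemma region_pos {n : ℕ} (hn : 1 ≤ n) (α : BComp n) {a : ℕ} (h : 0 < a) : 0 < region α a := by
  apply Finset.card_pos.2
  refine ⟨0, ?_⟩
  simp only [Finset.mem_filter, Finset.mem_range]
  refine ⟨?_, by simpa [pSum] using h⟩
  rw [List.length_pos_iff]
  intro h0
  have := α.sum_eq
  simp [h0] at this
  omega

lemma blockIdx_neg {n : ℕ} (α : BComp n) {x : ℤ} (hx : x ≠ 0) :
    blockIdx α (-x) = - blockIdx α x := by
  rcases lt_or_gt_of_ne hx with h | h
  · simp only [blockIdx, if_pos (show 0 < -x by omega), if_neg (show ¬ 0 < x by omega)]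
    split_ifs <;> simp
  · simp only [blockIdx, if_neg (show ¬ 0 < -x by omega), if_pos h, neg_neg]
    split_ifs <;> simp

lemma blockIdx_nonneg {n : ℕ} (α : BComp n) {x : ℤ} (hx : 0 < x) : 0 ≤ blockIdx α x := by
  rw [blockIdx, if_pos hx]
  split_ifs <;> omega

lemma blockIdx_mono_of_pos {n : ℕ} (hn : 1 ≤ n) (α : BComp n) {x y : ℤ} (hx : 0 < x)
    (h : x ≤ y) : blockIdx α x ≤ blockIdx α y := by
  have h1 := region_mono α (Int.toNat_le_toNat h)
  have h2 := region_pos hn α (show 0 < x.toNat by omega)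
  rw [blockIdx, if_pos hx, blockIdx, if_pos (by omega : 0 < y)]
  cases α.isJoin
  · simpa using h1
  · simp only [true_and]
    split_ifs <;> omega

lemma blockIdx_mono {n : ℕ} (hn : 1 ≤ n) (α : BComp n) {x y : ℤ} (hx : x ≠ 0) (hy : y ≠ 0)
    (h : x ≤ y) : blockIdx α x ≤ blockIdx α y := by
  rcases lt_or_gt_of_ne hx with hx' | hx'
  · have h1 := blockIdx_neg α hx
    rcases lt_or_gt_of_ne hy with hy' | hy'
    · have h2 := blockIdx_neg α hy
      have := blockIdx_mono_of_pos hn α (show 0 < -y by omega) (neg_le_neg h)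
      omega
    · have h2 := blockIdx_nonneg α (show 0 < -x by omega)
      have := blockIdx_nonneg α hy'
      omega
  · exact blockIdx_mono_of_pos hn α hx' h

lemma memH_iff {n : ℕ} {α : BComp n} {π : SignedPerm n} :
    memH α π ↔ ∀ a b, IsInv π a b → blockIdx α a ≠ blockIdx α b := by
  constructor
  · intro h a b ⟨ha, hb, hab, hlt⟩ he
    have := h a b ha hb hab he
    omega
  · intro h a b ha hb hab he
    have := π.perm_ne hab.ne
    by_contra hc
    exact h a b ⟨ha, hb, hab, by omega⟩ he

lemma memH_of_wle {n : ℕ} {α : BComp n} {π σ : SignedPerm n} (h : wle π σ) (hσ : memH α σ) :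
    memH α π :=
  memH_iff.2 fun a b hab => memH_iff.1 hσ a b (wle_iff.1 h a b hab)

lemma exists_isMeetIn {n : ℕ} {α : BComp n} {x y : SignedPerm n} (hx : memH α x) :
    ∃ m, isMeetIn (Hset α) x y m := by
  have hcx := (biclosed_isInv x).compl
  have hcy := (biclosed_isInv y).compl
  obtain ⟨m, hm⟩ :=
    (hcx.toCoclosed.sup hcy.toCoclosed).biclosed_transGen.compl.exists_signedPerm
  have hmx : wle m x := wle_iff.2 fun a b h => by
    obtain ⟨ha, hb, hab, hn⟩ := (hm a b).1 h
    by_contra hc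
    exact hn (.single (.inl ⟨ha, hb, hab, hc⟩))
  have hmy : wle m y := wle_iff.2 fun a b h => by
    obtain ⟨ha, hb, hab, hn⟩ := (hm a b).1 h
    by_contra hc
    exact hn (.single (.inr ⟨ha, hb, hab, hc⟩))
  refine ⟨m, memH_of_wle hmx hx, hmx, hmy, fun z _ hzx hzy => wle_iff.2 fun a b h => ?_⟩
  refine (hm a b).2 ⟨h.1, h.2.1, h.2.2.1, fun ht => ?_⟩
  have hle : ∀ a b, (complRel n (IsInv x) ⊔ complRel n (IsInv y)) a b →
      complRel n (IsInv z) a b := by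
    rintro a b (h | h)
    · exact ⟨h.1, h.2.1, h.2.2.1, fun hc => h.2.2.2 (wle_iff.1 hzx _ _ hc)⟩
    · exact ⟨h.1, h.2.1, h.2.2.1, fun hc => h.2.2.2 (wle_iff.1 hzy _ _ hc)⟩
  have hz := (biclosed_isInv z).compl
  have : complRel n (IsInv z) a b := by
    clear h
    induction ht with
    | single h => exact hle _ _ h
    | tail _ h ih => exact hz.trans ih (hle _ _ h)
  exact this.2.2.2 h

lemma transGen_isInv_le {n : ℕ} {x y z : SignedPerm n} (hx : wle x z) (hy : wle y z) {a b : ℤ}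
    (h : Relation.TransGen (IsInv x ⊔ IsInv y) a b) : IsInv z a b := by
  have hle : ∀ a b, (IsInv x ⊔ IsInv y) a b → IsInv z a b := fun a b h =>
    h.elim (wle_iff.1 hx a b) (wle_iff.1 hy a b)
  induction h with
  | single h => exact hle _ _ h
  | tail _ h ih => exact (biclosed_isInv z).trans ih (hle _ _ h)

/-- The join in `H_α` has the transitive closure of the union of the inversions as its
inversions. -/
lemma exists_isJoinIn {n : ℕ} (hn : 1 ≤ n) {α : BComp n} {x y : SignedPerm n} (hx : memH α x)
    (hy : memH α y) : ∃ u, isJoinIn (Hset α) x y u ∧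
      ∀ a b, IsInv u a b ↔ Relation.TransGen (IsInv x ⊔ IsInv y) a b := by
  have hco := (biclosed_isInv x).toCoclosed.sup (biclosed_isInv y).toCoclosed
  obtain ⟨u, hu⟩ := hco.biclosed_transGen.exists_signedPerm
  refine ⟨u, ⟨memH_iff.2 fun a b h => ?_, wle_iff.2 fun a b h => (hu a b).2 (.single (.inl h)),
    wle_iff.2 fun a b h => (hu a b).2 (.single (.inr h)), fun z _ hxz hyz =>
      wle_iff.2 fun a b h => transGen_isInv_le hxz hyz ((hu a b).1 h)⟩, hu⟩
  intro he
  obtain ⟨c, hac, hcb⟩ := Relation.TransGen.head'_iff.1 ((hu a b).1 h)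
  obtain ⟨ha, hc, hac'⟩ := hco.dom hac
  have hcb' : c ≤ b := by
    rcases Relation.reflTransGen_iff_eq_or_transGen.1 hcb with rfl | h
    · exact le_rfl
    · exact (hco.dom_transGen h).2.2.le
  have h1 := blockIdx_mono hn α ha.1 hc.1 hac'.le
  have h2 := blockIdx_mono hn α hc.1 h.2.1.1 hcb'
  have h3 : blockIdx α a = blockIdx α c := by omega
  rcases hac with h' | h'
  · exact memH_iff.1 hx _ _ h' h3
  · exact memH_iff.1 hy _ _ h' h3

/-- The side on which an index between the two ends of a descent (and in a different block)
has to lie in order not to create a pattern: `True` means above. -/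
def Above {n : ℕ} (α : BComp n) (j : ℤ) : Prop :=
  if α.isJoin = true ∧ |j| ≤ alpha1 α then 0 < j else j < 0

lemma above_neg {n : ℕ} (α : BComp n) {j : ℤ} (hj : j ≠ 0) : Above α (-j) ↔ ¬ Above α j := by
  unfold Above
  rw [abs_neg]
  split_ifs <;> omega

/-- The set `A` of indices above the arc from `i` to `k` has the prescribed sides,
and the join-irreducible permutation given by this arc has its inversions in `I`. -/
structure ArcWith {n : ℕ} (α : BComp n) (I : ℤ → ℤ → Prop) (A : Set ℤ) (i k : ℤ) :
    Prop where
  left : inPM n i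
  right : inPM n k
  lt : i < k
  side : ∀ j, inPM n j → i < j → j < k → blockIdx α j ≠ blockIdx α i →
    blockIdx α j ≠ blockIdx α k → (j ∈ A ↔ Above α j)
  inv : ∀ p q, inPM n p → inPM n q → i ≤ p → p < q → q ≤ k → (p = i ∨ p ∈ A) →
    (q = k ∨ q ∉ A) → I p q

/-- The pairs `(i, k)` joined by an admissible arc below `I`. -/
def ArcRel {n : ℕ} (α : BComp n) (I : ℤ → ℤ → Prop) (i k : ℤ) : Prop :=
  ∃ A, ArcWith α I A i k

lemma side_restrict {n : ℕ} (hn : 1 ≤ n) {α : BComp n} {A : Set ℤ} {i k p q : ℤ}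
    (hi : inPM n i) (hk : inPM n k) (hp : inPM n p) (hq : inPM n q) (hip : i ≤ p) (hqk : q ≤ k)
    (h : ∀ j, inPM n j → i < j → j < k → blockIdx α j ≠ blockIdx α i →
      blockIdx α j ≠ blockIdx α k → (j ∈ A ↔ Above α j)) :
    ∀ j, inPM n j → p < j → j < q → blockIdx α j ≠ blockIdx α p →
      blockIdx α j ≠ blockIdx α q → (j ∈ A ↔ Above α j) := by
  intro j hj hpj hjq h1 h2
  have e1 := blockIdx_mono hn α hi.1 hp.1 hip
  have e2 := blockIdx_mono hn α hp.1 hj.1 hpj.le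
  have e3 := blockIdx_mono hn α hj.1 hq.1 hjq.le
  have e4 := blockIdx_mono hn α hq.1 hk.1 hqk
  exact h j hj (by omega) (by omega) (by omega) (by omega)

lemma ArcWith.restrict {n : ℕ} (hn : 1 ≤ n) {α : BComp n} {I : ℤ → ℤ → Prop} {A : Set ℤ}
    {i k p q : ℤ} (h : ArcWith α I A i k) (hp : inPM n p) (hq : inPM n q) (hip : i ≤ p)
    (hpq : p < q) (hqk : q ≤ k) (hpA : p = i ∨ p ∈ A) (hqA : q = k ∨ q ∉ A) :
    ArcWith α I A p q where
  left := hp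
  right := hq
  lt := hpq
  side := side_restrict hn h.left h.right hp hq hip hqk h.side
  inv p' q' hp' hq' h1 h2 h3 h4 h5 := by
    refine h.inv p' q' hp' hq' (by omega) h2 (by omega) ?_ ?_
    · rcases h4 with rfl | h4
      · exact hpA
      · exact .inr h4
    · rcases h5 with rfl | h5
      · exact hqA
      · exact .inr h5

lemma ArcWith.mono {n : ℕ} {α : BComp n} {I J : ℤ → ℤ → Prop} {A : Set ℤ} {i k : ℤ}
    (h : ArcWith α I A i k) (hIJ : ∀ a b, I a b → J a b) : ArcWith α J A i k :=
  { h with inv := fun p q a b c d e f g => hIJ _ _ (h.inv p q a b c d e f g) }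

lemma ArcRel.le {n : ℕ} {α : BComp n} {I : ℤ → ℤ → Prop} {i k : ℤ} (h : ArcRel α I i k) :
    I i k := by
  obtain ⟨A, h⟩ := h
  exact h.inv i k h.left h.right le_rfl h.lt le_rfl (.inl rfl) (.inl rfl)

lemma coclosed_arcRel {n : ℕ} (hn : 1 ≤ n) {α : BComp n} {I : ℤ → ℤ → Prop}
    (hI : Coclosed n I) : Coclosed n (ArcRel α I) where
  dom h := hI.dom h.le
  cotrans {a b c} h hb hab hbc := by
    obtain ⟨A, h⟩ := h
    by_cases hA : b ∈ A
    · exact .inr ⟨A, h.restrict hn hb h.right hab.le hbc le_rfl (.inr hA) (.inl rfl)⟩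
    · exact .inl ⟨A, h.restrict hn h.left hb le_rfl hab hbc.le (.inl rfl) (.inr hA)⟩
  symm {a b} h := by
    obtain ⟨A, h⟩ := h
    refine ⟨{j | -j ∉ A}, h.right.neg, h.left.neg, by have := h.lt; omega, ?_, ?_⟩
    · intro j hj h1 h2 h3 h4
      rw [blockIdx_neg α h.left.1] at h4
      rw [blockIdx_neg α h.right.1] at h3
      have h5 := blockIdx_neg α hj.1
      have := h.side (-j) hj.neg (by omega) (by omega) (by omega) (by omega)
      rw [above_neg α hj.1] at this
      simp only [Set.mem_ofPred_eq]
      tauto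
    · intro p q hp hq h1 h2 h3 h4 h5
      have := h.inv (-q) (-p) hq.neg hp.neg (by omega) (by omega) (by omega)
        (h5.imp (by omega) (by simp)) (h4.imp (by omega) (by simp))
      simpa using hI.symm this

lemma exists_crossing {r : ℤ → ℤ → Prop} (hr : ∀ a b, r a b → a < b) {i k : ℤ}
    (h : Relation.TransGen r i k) (Q : ℤ → Prop) (hi : Q i) (hk : ¬ Q k) :
    ∃ a b, r a b ∧ i ≤ a ∧ b ≤ k ∧ Q a ∧ ¬ Q b := by
  induction h with
  | single h => exact ⟨_, _, h, le_rfl, le_rfl, hi, hk⟩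
  | @tail b c hab hbc ih =>
    have hib : i < b := by
      clear ih hbc
      induction hab with
      | single h => exact hr _ _ h
      | tail _ h ih' => exact ih'.trans (hr _ _ h)
    by_cases hQ : Q b
    · exact ⟨b, c, hbc, hib.le, le_rfl, hQ, hk⟩
    · obtain ⟨a, b', h1, h2, h3, h4, h5⟩ := ih hQ
      exact ⟨a, b', h1, h2, h3.trans (hr _ _ hbc).le, h4, h5⟩

/-- Given a step of `I` leaving the lower side of an arc for its upper side, a shortest such
step is itself an admissible arc. -/
lemma exists_arcWith_of_step {n : ℕ} (hn : 1 ≤ n) {α : BComp n} {I : ℤ → ℤ → Prop}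
    (hI : Coclosed n I) {A : Set ℤ} {i k : ℤ} (hi : inPM n i) (hk : inPM n k)
    (hside : ∀ j, inPM n j → i < j → j < k → blockIdx α j ≠ blockIdx α i →
      blockIdx α j ≠ blockIdx α k → (j ∈ A ↔ Above α j)) (N : ℕ) :
    ∀ a b, (b - a).toNat ≤ N → I a b → i ≤ a → b ≤ k → (a = i ∨ a ∉ A) → (b = k ∨ b ∈ A) →
      ∃ a' b', i ≤ a' ∧ b' ≤ k ∧ (a' = i ∨ a' ∉ A) ∧ (b' = k ∨ b' ∈ A) ∧
        ArcWith α I A a' b' := by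
  induction N with
  | zero =>
    intro a b hN hab
    have := (hI.dom hab).2.2
    omega
  | succ N ih =>
    intro a b hN hab hia hbk ha hb
    obtain ⟨haM, hbM, hlt⟩ := hI.dom hab
    by_cases h1 : ∃ r, a < r ∧ r < b ∧ r ∈ A ∧ I a r
    · obtain ⟨r, har, hrb, hrA, hr⟩ := h1
      exact ih a r (by omega) hr hia (by omega) ha (.inr hrA)
    by_cases h2 : ∃ r, a < r ∧ r < b ∧ r ∉ A ∧ I r b
    · obtain ⟨r, har, hrb, hrA, hr⟩ := h2
      exact ih r b (by omega) hr (by omega) hbk (.inr hrA) hb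
    push Not at h1 h2
    refine ⟨a, b, hia, hbk, ha, hb, haM, hbM, hlt,
      side_restrict hn hi hk haM hbM hia hbk hside, ?_⟩
    have hA : ∀ r, inPM n r → a < r → r < b → r ∈ A → I r b := fun r hr har hrb hrA =>
      (hI.cotrans hab hr har hrb).resolve_left (h1 r har hrb hrA)
    have hA' : ∀ r, inPM n r → a < r → r < b → r ∉ A → I a r := fun r hr har hrb hrA =>
      (hI.cotrans hab hr har hrb).resolve_right (h2 r har hrb hrA)
    intro p q hp hq hap hpq hqb hpA hqA
    rcases hap.eq_or_lt with rfl | hap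
    · rcases hqb.eq_or_lt with rfl | hqb
      · exact hab
      · exact hA' q hq hpq hqb (hqA.resolve_left hqb.ne)
    · have hpA' := hpA.resolve_left hap.ne'
      have hpb := hA p hp hap (by omega) hpA'
      rcases hqb.eq_or_lt with rfl | hqb
      · exact hpb
      · exact (hI.cotrans hpb hq hpq hqb).resolve_right
          (h2 q (by omega) hqb (hqA.resolve_left hqb.ne))

/-- Arcs below a join are generated by the arcs below the two joinands. -/
theorem transGen_arcRel_of_arcWith {n : ℕ} (hn : 1 ≤ n) {α : BComp n} {I J : ℤ → ℤ → Prop}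
    (hI : Coclosed n I) (hJ : Coclosed n J) {A : Set ℤ} (N : ℕ) :
    ∀ i k, (k - i).toNat ≤ N → ArcWith α (Relation.TransGen (I ⊔ J)) A i k →
      Relation.TransGen (ArcRel α I ⊔ ArcRel α J) i k := by
  induction N with
  | zero =>
    intro i k hN h
    have := h.lt
    omega
  | succ N ih =>
    intro i k hN h
    have hIJ := hI.sup hJ
    have hik := h.inv i k h.left h.right le_rfl h.lt le_rfl (.inl rfl) (.inl rfl)
    obtain ⟨a, b, hab, hia, hbk, ha, hb⟩ := exists_crossing (fun a b h => (hIJ.dom h).2.2) hik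
      (fun x => x ≠ k ∧ (x = i ∨ x ∉ A)) ⟨h.lt.ne, .inl rfl⟩ (by simp)
    have hb' : b = k ∨ b ∈ A := by tauto
    have harc : ∃ a b, i ≤ a ∧ b ≤ k ∧ (a = i ∨ a ∉ A) ∧ (b = k ∨ b ∈ A) ∧
        (ArcRel α I ⊔ ArcRel α J) a b := by
      rcases hab with hab | hab
      · obtain ⟨a', b', h1, h2, h3, h4, h5⟩ := exists_arcWith_of_step hn hI h.left h.right
          h.side _ a b le_rfl hab hia hbk ha.2 hb'
        exact ⟨a', b', h1, h2, h3, h4, .inl ⟨A, h5⟩⟩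
      · obtain ⟨a', b', h1, h2, h3, h4, h5⟩ := exists_arcWith_of_step hn hJ h.left h.right
          h.side _ a b le_rfl hab hia hbk ha.2 hb'
        exact ⟨a', b', h1, h2, h3, h4, .inr ⟨A, h5⟩⟩
    clear hab hia hbk ha hb hb' a b
    obtain ⟨a, b, hia, hbk, ha, hb, hab⟩ := harc
    obtain ⟨haM, hbM, hlt⟩ := ((coclosed_arcRel hn hI).sup (coclosed_arcRel hn hJ)).dom hab
    have hib : Relation.TransGen (ArcRel α I ⊔ ArcRel α J) i b := by
      rcases hia.eq_or_lt with rfl | hia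
      · exact .single hab
      · exact (ih i a (by omega) (h.restrict hn h.left haM le_rfl hia (by omega) (.inl rfl)
          (.inr (ha.resolve_left hia.ne')))).tail hab
    rcases hbk.eq_or_lt with rfl | hbk
    · exact hib
    · exact hib.trans (ih b k (by omega) (h.restrict hn hbM h.right (by omega) hbk le_rfl
        (.inr (hb.resolve_left hbk.ne)) (.inl rfl)))

lemma neg_eq_iplus {v w : ℤ} (hw : w ≠ 0) (h : v = iplus w) : -w = iplus (-v) := by
  unfold iplus at *
  split_ifs at * <;> omega

/-- In a pattern-avoiding permutation, the indices between the ends of a descent lie on the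
prescribed side. -/
lemma above_iff_of_not_has231 {n : ℕ} (hn : 1 ≤ n) {α : BComp n} {z : SignedPerm n}
    (hz : ¬ has231 α z) {i j k : ℤ} (hi : inPM n i) (hj : inPM n j) (hk : inPM n k)
    (hij : i < j) (hjk : j < k) (h1 : blockIdx α j ≠ blockIdx α i)
    (h2 : blockIdx α j ≠ blockIdx α k) (hd : z.perm i = iplus (z.perm k)) :
    z.perm i < z.perm j ↔ Above α j := by
  have hpos : ∀ {i j k : ℤ}, inPM n i → inPM n j → inPM n k → i < j → j < k →
      blockIdx α j ≠ blockIdx α i → blockIdx α j ≠ blockIdx α k →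
      z.perm i = iplus (z.perm k) → 0 < j → (z.perm i < z.perm j ↔ Above α j) := by
    intro i j k hi hj hk hij hjk h1 h2 hd hj0
    have e1 := blockIdx_mono hn α hi.1 hj.1 hij.le
    have e2 := blockIdx_mono hn α hj.1 hk.1 hjk.le
    have hcore : patternCore α z i j k :=
      ⟨hi, hj, hk, hij, hjk, hj0, h1.symm, h2, by omega, hd⟩
    have hnp : ¬ _ := fun h => hz ⟨i, j, k, hcore, h⟩
    have n1 := z.perm_ne hij.ne
    have n2 := z.perm_ne hjk.ne
    have n3 := (z.perm_inPM hj).1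
    have hd' : z.perm i < z.perm j ∨ z.perm j < z.perm k := by
      unfold iplus at hd
      split_ifs at hd <;> omega
    have hd'' : z.perm k < z.perm i := by
      unfold iplus at hd
      split_ifs at hd <;> omega
    unfold Above
    rw [abs_of_pos hj0]
    cases hJ : α.isJoin
    · simp only [hJ, Bool.false_eq_true, if_false, false_and] at hnp ⊢
      omega
    · simp only [hJ, if_true, true_and] at hnp ⊢
      by_cases hja : j ≤ alpha1 α
      · simp only [hja, if_true]
        have : ¬ z.perm j < z.perm k := fun h => hnp ⟨by omega, fun _ => h⟩
        omega
      · simp only [hja, if_false]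
        have : ¬ z.perm i < z.perm j := fun h => hnp ⟨fun _ => h, by omega⟩
        omega
  rcases lt_or_gt_of_ne hj.1 with hj0 | hj0
  · have e1 := blockIdx_neg α hi.1
    have e2 := blockIdx_neg α hj.1
    have e3 := blockIdx_neg α hk.1
    have := hpos hk.neg hj.neg hi.neg (by omega) (by omega) (by omega) (by omega)
      (by rw [z.sign_symm, z.sign_symm]; exact neg_eq_iplus (z.perm_inPM hk).1 hd) (by omega)
    rw [above_neg α hj.1, z.sign_symm, z.sign_symm] at this
    have n1 := z.perm_ne hij.ne
    have n2 := z.perm_ne hjk.ne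
    have n3 := (z.perm_inPM hj).1
    rw [← not_iff_not, ← this]
    unfold iplus at hd
    split_ifs at hd <;> omega
  · exact hpos hi hj hk hij hjk h1 h2 hd hj0

/-- An inversion without intermediate values at intermediate positions is spanned by a
descent. -/
lemma exists_descent {n : ℕ} {z : SignedPerm n} {i k : ℤ}
    (hno : ∀ m, inPM n m → i < m → m < k → ¬ (z.perm k < z.perm m ∧ z.perm m < z.perm i))
    (N : ℕ) : ∀ k', (z.perm i - z.perm k').toNat ≤ N → inPM n i → inPM n k' → k ≤ k' →
      z.perm k ≤ z.perm k' → z.perm k' < z.perm i →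
      ∃ i' k', inPM n i' ∧ inPM n k' ∧ i' ≤ i ∧ k ≤ k' ∧ z.perm i' = iplus (z.perm k') ∧
        z.perm i' ≤ z.perm i ∧ z.perm k ≤ z.perm k' := by
  induction N with
  | zero =>
    intro k' hN hi hk' hkk hz hlt
    omega
  | succ N ih =>
    intro k' hN hi hk' hkk hz hlt
    have hzi := z.perm_inPM hi
    have hzk := z.perm_inPM hk'
    have hw : inPM n (iplus (z.perm k')) ∧ z.perm k' < iplus (z.perm k') ∧
        iplus (z.perm k') ≤ z.perm i := by
      unfold inPM iplus at *
      split_ifs <;> omega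
    obtain ⟨m, hm, hmw⟩ := z.exists_perm_eq hw.1
    rw [← hmw] at hw
    by_cases hmi : m ≤ i
    · exact ⟨m, k', hm, hk', hmi, hkk, hmw, hw.2.2, hz⟩
    · have hne := z.perm_ne (show m ≠ i by omega)
      have hmk : k ≤ m := by
        by_contra hc
        exact hno m hm (by omega) (by omega) ⟨by omega, by omega⟩
      exact ih m (by omega) hi hm hmk (by omega) (by omega)

/-- The inversions of a pattern-avoiding permutation are generated by its admissible arcs. -/
theorem transGen_arcRel_of_isInv {n : ℕ} (hn : 1 ≤ n) {α : BComp n} {z : SignedPerm n}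
    (hz : ¬ has231 α z) (N : ℕ) : ∀ i k, (z.perm i - z.perm k).toNat ≤ N → IsInv z i k →
      Relation.TransGen (ArcRel α (IsInv z)) i k := by
  induction N with
  | zero =>
    intro i k hN h
    have := h.2.2.2
    omega
  | succ N ih =>
    intro i k hN ⟨hi, hk, hik, hlt⟩
    by_cases hex : ∃ m, inPM n m ∧ i < m ∧ m < k ∧ z.perm k < z.perm m ∧ z.perm m < z.perm i
    · obtain ⟨m, hm, him, hmk, h1, h2⟩ := hex
      exact (ih i m (by omega) ⟨hi, hm, him, h2⟩).trans (ih m k (by omega) ⟨hm, hk, hmk, h1⟩)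
    push Not at hex
    obtain ⟨i', k', hi', hk', hii, hkk, hd, hzi, hzk⟩ := exists_descent
      (fun m hm him hmk h => absurd h.2 (not_lt.2 (hex m hm him hmk h.1))) _ k le_rfl
        hi hk le_rfl le_rfl hlt
    refine .single ⟨{j | z.perm i < z.perm j}, hi, hk, hik, ?_, ?_⟩
    · intro j hj hij hjk h1 h2
      have e1 := blockIdx_mono hn α hi'.1 hi.1 hii
      have e2 := blockIdx_mono hn α hi.1 hj.1 hij.le
      have e3 := blockIdx_mono hn α hj.1 hk.1 hjk.le
      have e4 := blockIdx_mono hn α hk.1 hk'.1 hkk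
      rw [← above_iff_of_not_has231 hn hz hi' hj hk' (by omega) (by omega) (by omega)
        (by omega) hd]
      have := hex j hj hij hjk
      have n1 := z.perm_ne hij.ne
      have n2 := z.perm_ne hjk.ne
      have hgt : z.perm k' < z.perm i' := by
        unfold iplus at hd
        split_ifs at hd <;> omega
      simp only [Set.mem_ofPred_eq]
      omega
    · intro p q hp hq hip hpq hqk hpA hqA
      refine ⟨hp, hq, hpq, ?_⟩
      have h1 : z.perm i ≤ z.perm p := by
        rcases hpA with rfl | h
        · exact le_rfl
        · exact le_of_lt h
      have h2 : z.perm q ≤ z.perm k := by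
        rcases hqA with rfl | h
        · exact le_rfl
        · rcases hqk.eq_or_lt with rfl | hqk
          · exact le_rfl
          · have := hex q hq (by omega) hqk
            have n1 := z.perm_ne (show q ≠ i by omega)
            simp only [Set.mem_ofPred_eq] at h
            omega
      omega

/-- Below each element of `H_α` there is a pattern-avoiding one containing all
its admissible arcs. -/
theorem exists_mem231_arcRel_le {n : ℕ} (hn : 1 ≤ n) {α : BComp n} {π : SignedPerm n}
    (hπ : memH α π) : ∃ d, mem231 α d ∧ wle d π ∧
      ∀ i k, ArcRel α (IsInv π) i k → IsInv d i k := by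
  obtain ⟨d, hd⟩ :=
    (coclosed_arcRel (α := α) hn (biclosed_isInv π).toCoclosed).biclosed_transGen.exists_signedPerm
  have hle : wle d π := wle_iff.2 fun a b h => by
    have := (hd a b).1 h
    clear h
    induction this with
    | single h => exact h.le
    | tail _ h ih => exact (biclosed_isInv π).trans ih h.le
  have harc : ∀ i k, ArcRel α (IsInv π) i k → IsInv d i k := fun i k h => (hd i k).2 (.single h)
  refine ⟨d, ⟨memH_of_wle hle hπ, ?_⟩, hle, harc⟩
  rintro ⟨i, j, k, ⟨hi, hj, hk, hij, hjk, hj0, h1, h2, h3, hdesc⟩, hpat⟩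
  have hgt : d.perm k < d.perm i := by
    unfold iplus at hdesc
    split_ifs at hdesc <;> omega
  have hadj : ∀ v, v ≠ 0 → ¬ (d.perm k < v ∧ v < d.perm i) := by
    intro v hv
    unfold iplus at hdesc
    split_ifs at hdesc <;> omega
  obtain ⟨A, hA⟩ : ArcRel α (IsInv π) i k := by
    obtain ⟨m, him, hmk⟩ := Relation.TransGen.head'_iff.1
      ((hd i k).1 ⟨hi, hk, hij.trans hjk, hgt⟩)
    rcases Relation.reflTransGen_iff_eq_or_transGen.1 hmk with rfl | hmk
    · exact him
    · have e1 := harc i m him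
      have e2 := (hd m k).2 hmk
      exact absurd ⟨e2.2.2.2, e1.2.2.2⟩ (hadj _ (d.perm_inPM e1.2.1).1)
  have n1 := d.perm_ne hij.ne
  have n2 := d.perm_ne hjk.ne
  have hj' := hadj _ (d.perm_inPM hj).1
  have hside := hA.side j hj hij hjk h1.symm h2
  have hin : j ∈ A → d.perm i < d.perm j := fun h => by
    have := (harc j k ⟨A, hA.restrict hn hj hk hij.le hjk le_rfl (.inr h) (.inl rfl)⟩).2.2.2
    omega
  have hout : j ∉ A → d.perm j < d.perm k := fun h => by
    have := (harc i j ⟨A, hA.restrict hn hi hj le_rfl hij hjk.le (.inl rfl) (.inr h)⟩).2.2.2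
    omega
  unfold Above at hside
  rw [abs_of_pos hj0] at hside
  cases hJ : α.isJoin
  · simp only [hJ, Bool.false_eq_true, if_false, false_and] at hside hpat
    have := hout (by rw [hside]; omega)
    omega
  · simp only [hJ, if_true, true_and] at hside hpat
    by_cases hja : j ≤ alpha1 α
    · simp only [hja, if_true] at hside
      have := hin (hside.2 hj0)
      have := hpat.2 hja
      omega
    · simp only [hja, if_false] at hside
      have := hout (by rw [hside]; omega)
      have := hpat.1 (by omega)
      omega

lemma arcRel_le_of_isProjDown {n : ℕ} (hn : 1 ≤ n) {α : BComp n} {π d : SignedPerm n}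
    (hπ : memH α π) (hd : isProjDown α π d) {i k : ℤ} (h : ArcRel α (IsInv π) i k) :
    IsInv d i k := by
  obtain ⟨d', hd', hle, harc⟩ := exists_mem231_arcRel_le hn hπ
  exact wle_iff.1 (hd.2.2 d' hd' hle) i k (harc i k h)

/-- A pattern-avoiding permutation below a join lies below every upper bound of the
projections of the joinands. -/
theorem wle_of_wle_isJoinIn {n : ℕ} (hn : 1 ≤ n) {α : BComp n}
    {π₁ π₂ d₁ d₂ j z w : SignedPerm n} (h₁ : memH α π₁) (h₂ : memH α π₂)
    (hd₁ : isProjDown α π₁ d₁) (hd₂ : isProjDown α π₂ d₂) (hj : isJoinIn (Hset α) π₁ π₂ j)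
    (hz : mem231 α z) (hzj : wle z j) (hw₁ : wle d₁ w) (hw₂ : wle d₂ w) : wle z w := by
  obtain ⟨u, hu, hinv⟩ := exists_isJoinIn hn h₁ h₂
  have hzu : wle z u := hzj.trans (hj.2.2.2 u hu.1 hu.2.1 hu.2.2.1)
  have hstep : ∀ a b, (ArcRel α (IsInv π₁) ⊔ ArcRel α (IsInv π₂)) a b →
      (IsInv d₁ ⊔ IsInv d₂) a b := fun a b h =>
    h.imp (arcRel_le_of_isProjDown hn h₁ hd₁) (arcRel_le_of_isProjDown hn h₂ hd₂)
  have harc : ∀ a b, ArcRel α (IsInv z) a b → IsInv w a b := by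
    rintro a b ⟨A, hA⟩
    have hA' := hA.mono fun p q h => (hinv p q).1 (wle_iff.1 hzu p q h)
    exact transGen_isInv_le hw₁ hw₂ (Relation.TransGen.mono hstep a b
      (transGen_arcRel_of_arcWith hn (biclosed_isInv π₁).toCoclosed
        (biclosed_isInv π₂).toCoclosed _ a b le_rfl hA'))
  refine wle_iff.2 fun a b h => ?_
  have := transGen_arcRel_of_isInv hn hz.2 _ a b le_rfl h
  clear h
  induction this with
  | single h => exact harc _ _ h
  | tail _ h ih => exact (biclosed_isInv w).trans ih (harc _ _ h)

/-- For every type-B composition `α` of `n`, the weak order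
on `H_α` is a lattice; the equivalence relation `Θ` identifying `π` and `σ`
whenever `Π↓(π) = Π↓(σ)` is a lattice congruence of it (compatible with joins
and meets); and `Π↓(π)` is the least element of the `Θ`-class of `π`. -/
theorem weak_order_lattice_and_congruence (n : ℕ) (hn : 1 ≤ n) (α : BComp n) :
    (∀ x y : SignedPerm n, memH α x → memH α y →
        (∃ m, isMeetIn (Hset α) x y m) ∧ (∃ u, isJoinIn (Hset α) x y u)) ∧
    (∀ π₁ π₂ σ₁ σ₂ : SignedPerm n, memH α π₁ → memH α π₂ → memH α σ₁ → memH α σ₂ →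
      ∀ d₁ d₂ : SignedPerm n,
        isProjDown α π₁ d₁ → isProjDown α σ₁ d₁ →
        isProjDown α π₂ d₂ → isProjDown α σ₂ d₂ →
        (∀ jπ jσ eπ eσ : SignedPerm n,
            isJoinIn (Hset α) π₁ π₂ jπ → isJoinIn (Hset α) σ₁ σ₂ jσ →
            isProjDown α jπ eπ → isProjDown α jσ eσ → eπ = eσ) ∧
        (∀ mπ mσ eπ eσ : SignedPerm n,
            isMeetIn (Hset α) π₁ π₂ mπ → isMeetIn (Hset α) σ₁ σ₂ mσ →
            isProjDown α mπ eπ → isProjDown α mσ eσ → eπ = eσ)) ∧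
    (∀ π d : SignedPerm n, memH α π → isProjDown α π d →
      isProjDown α d d ∧ ∀ σ, memH α σ → isProjDown α σ d → wle d σ) := by
  refine ⟨fun x y hx hy => ⟨exists_isMeetIn hx, ?_⟩, ?_, ?_⟩
  · obtain ⟨u, hu, -⟩ := exists_isJoinIn hn hx hy
    exact ⟨u, hu⟩
  · intro π₁ π₂ σ₁ σ₂ hπ₁ hπ₂ hσ₁ hσ₂ d₁ d₂ p₁ s₁ p₂ s₂
    refine ⟨fun jπ jσ eπ eσ hjπ hjσ heπ heσ => ?_, fun mπ mσ eπ eσ hmπ hmσ heπ heσ => ?_⟩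
    · apply wle.antisymm
      · exact heσ.2.2 _ heπ.1 (wle_of_wle_isJoinIn hn hπ₁ hπ₂ p₁ p₂ hjπ heπ.1 heπ.2.1
          (s₁.2.1.trans hjσ.2.1) (s₂.2.1.trans hjσ.2.2.1))
      · exact heπ.2.2 _ heσ.1 (wle_of_wle_isJoinIn hn hσ₁ hσ₂ s₁ s₂ hjσ heσ.1 heσ.2.1
          (p₁.2.1.trans hjπ.2.1) (p₂.2.1.trans hjπ.2.2.1))
    · apply wle.antisymm
      · exact heσ.2.2 _ heπ.1 (hmσ.2.2.2 _ heπ.1.1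
          ((p₁.2.2 _ heπ.1 (heπ.2.1.trans hmπ.2.1)).trans s₁.2.1)
          ((p₂.2.2 _ heπ.1 (heπ.2.1.trans hmπ.2.2.1)).trans s₂.2.1))
      · exact heπ.2.2 _ heσ.1 (hmπ.2.2.2 _ heσ.1.1
          ((s₁.2.2 _ heσ.1 (heσ.2.1.trans hmσ.2.1)).trans p₁.2.1)
          ((s₂.2.2 _ heσ.1 (heσ.2.1.trans hmσ.2.2.1)).trans p₂.2.1))
  · intro π d _ hd
    exact ⟨⟨hd.1, Set.Subset.refl _, fun σ _ h => h⟩, fun σ _ h => h.2.1⟩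

end TypeB
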